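/- Let V be a finite dimensional complex vector space of dimension n and G a finite unitary reflection group acting on V. Then the reduced homology H~_{n-1}(U'_1^V(G)) is isomorphic as a ZG-module to H~_{n-2}(S~_1^V(G)). -/

import Mathlib

/-! Ordered chains, the augmented simplicial chain complex of the order complex of a poset
(given by an arbitrary strict-order relation), reduced homology, and induced maps. -/

/-- Ordered chains with `n` vertices with respect to a relation `r`
(the `(n-1)`-simplices of the order complex). -/
def OCh (α : Type*) (r : α → α → Prop) (n : ℕ) : Type _ :=
  {f : Fin n → α // ∀ ⦃i j : Fin n⦄, i < j → r (f i) (f j)}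

/-- The augmented simplicial chain group with `n`-vertex chains as basis
(`n = 0` gives the augmentation degree `-1`). -/
abbrev ACh (α : Type*) (r : α → α → Prop) (n : ℕ) := OCh α r n →₀ ℤ

/-- The `i`-th face of an `(n+1)`-vertex ordered chain. -/
def OCh.face {α : Type*} {r : α → α → Prop} {n : ℕ} (c : OCh α r (n + 1)) (i : Fin (n + 1)) :
    OCh α r n :=
  ⟨c.1 ∘ i.succAbove, fun _ _ h => c.2 (Fin.strictMono_succAbove i h)⟩

/-- The simplicial boundary map of the augmented chain complex. -/
noncomputable def bdry (α : Type*) (r : α → α → Prop) (n : ℕ) :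
    ACh α r (n + 1) →ₗ[ℤ] ACh α r n :=
  Finsupp.lsum ℤ fun c => LinearMap.toSpanSingleton ℤ _
    (∑ i : Fin (n + 1), ((-1 : ℤ) ^ (i : ℕ)) • Finsupp.single (c.face i) (1 : ℤ))

/-- Augmented `n`-cycles (chains with `n+1` vertices). -/
noncomputable def cyc (α : Type*) (r : α → α → Prop) (n : ℕ) :
    Submodule ℤ (ACh α r (n + 1)) := LinearMap.ker (bdry α r n)

/-- Augmented `n`-boundaries (chains with `n+1` vertices). -/
noncomputable def bdries (α : Type*) (r : α → α → Prop) (n : ℕ) :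
    Submodule ℤ (ACh α r (n + 1)) := LinearMap.range (bdry α r (n + 1))

/-- Reduced simplicial homology `H̃ₙ` (over `ℤ`) of the order complex of `(α, r)`. -/
noncomputable abbrev redH (α : Type*) (r : α → α → Prop) (n : ℕ) :=
  cyc α r n ⧸ (bdries α r n).comap (cyc α r n).subtype

/-- Reduced homology in degree `-1`. -/
noncomputable abbrev redHneg (α : Type*) (r : α → α → Prop) :=
  (⊤ : Submodule ℤ (ACh α r 0)) ⧸
    (LinearMap.range (bdry α r 0)).comap (⊤ : Submodule ℤ (ACh α r 0)).subtype

section maps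

variable {α β : Type*} {rα : α → α → Prop} {rβ : β → β → Prop}

/-- The simplicial map on ordered chains induced by a relation-preserving map. -/
def cmap (f : α → β) (hf : ∀ ⦃a b⦄, rα a b → rβ (f a) (f b)) {n : ℕ} (c : OCh α rα n) :
    OCh β rβ n :=
  ⟨f ∘ c.1, fun _ _ h => hf (c.2 h)⟩

/-- The induced map on augmented chain groups. -/
noncomputable def cmapL (f : α → β) (hf : ∀ ⦃a b⦄, rα a b → rβ (f a) (f b)) (n : ℕ) :
    ACh α rα n →ₗ[ℤ] ACh β rβ n :=
  Finsupp.lmapDomain ℤ ℤ (cmap f hf)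

theorem bdry_single {n : ℕ} (c : OCh α rα (n + 1)) (b : ℤ) :
    bdry α rα n (Finsupp.single c b) =
      b • ∑ i : Fin (n + 1), ((-1 : ℤ) ^ (i : ℕ)) • Finsupp.single (c.face i) (1 : ℤ) := by
  simp [bdry, Finsupp.lsum_single, LinearMap.toSpanSingleton_apply]

theorem face_cmap (f : α → β) (hf : ∀ ⦃a b⦄, rα a b → rβ (f a) (f b)) {n : ℕ}
    (c : OCh α rα (n + 1)) (i : Fin (n + 1)) :
    (cmap f hf c).face i = cmap f hf (c.face i) := rfl

/-- Naturality of the boundary map. -/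
theorem bdry_cmapL (f : α → β) (hf : ∀ ⦃a b⦄, rα a b → rβ (f a) (f b)) (n : ℕ) :
    (bdry β rβ n).comp (cmapL f hf (n + 1)) = (cmapL f hf n).comp (bdry α rα n) := by
  refine Finsupp.lhom_ext fun c b => ?_
  simp only [LinearMap.comp_apply, cmapL, Finsupp.lmapDomain_apply, Finsupp.mapDomain_single,
    bdry_single]
  rw [← Finsupp.lmapDomain_apply ℤ ℤ (cmap f hf), map_smul, map_sum]
  simp [Finsupp.lmapDomain_apply, Finsupp.mapDomain_single, face_cmap]

theorem cmapL_mem_cyc (f : α → β) (hf : ∀ ⦃a b⦄, rα a b → rβ (f a) (f b)) {n : ℕ}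
    {z : ACh α rα (n + 1)} (hz : z ∈ cyc α rα n) :
    cmapL f hf (n + 1) z ∈ cyc β rβ n := by
  have := congrArg (fun φ : ACh α rα (n+1) →ₗ[ℤ] ACh β rβ n => φ z) (bdry_cmapL f hf n)
  simp only [LinearMap.comp_apply] at this
  simp only [cyc, LinearMap.mem_ker] at hz ⊢
  rw [this, hz, map_zero]

/-- The induced map on reduced homology of a relation-preserving map. -/
noncomputable def indH (f : α → β) (hf : ∀ ⦃a b⦄, rα a b → rβ (f a) (f b)) (n : ℕ) :
    redH α rα n →ₗ[ℤ] redH β rβ n :=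
  Submodule.mapQ _ _
    ((cmapL f hf (n + 1)).restrict (fun _ hz => cmapL_mem_cyc f hf hz))
    (by
      rintro ⟨z, hz⟩ hmem
      simp only [Submodule.mem_comap, bdries, LinearMap.mem_range] at hmem ⊢
      obtain ⟨w, hw⟩ := hmem
      refine ⟨cmapL f hf (n + 2) w, ?_⟩
      have := congrArg (fun φ : ACh α rα (n+2) →ₗ[ℤ] ACh β rβ (n+1) => φ w) (bdry_cmapL f hf (n+1))
      simp only [LinearMap.comp_apply] at this
      simp only [LinearMap.restrict_apply]
      rw [this, hw]
      rfl)

/-- The induced map on reduced homology in degree `-1`. -/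
noncomputable def indHneg (f : α → β) (hf : ∀ ⦃a b⦄, rα a b → rβ (f a) (f b)) :
    redHneg α rα →ₗ[ℤ] redHneg β rβ :=
  Submodule.mapQ _ _ ((cmapL f hf 0).restrict (fun _ _ => Submodule.mem_top))
    (by
      rintro ⟨z, hz⟩ hmem
      simp only [Submodule.mem_comap, LinearMap.mem_range] at hmem ⊢
      obtain ⟨w, hw⟩ := hmem
      refine ⟨cmapL f hf 1 w, ?_⟩
      have := congrArg (fun φ : ACh α rα 1 →ₗ[ℤ] ACh β rβ 0 => φ w) (bdry_cmapL f hf 0)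
      simp only [LinearMap.comp_apply] at this
      simp only [LinearMap.restrict_apply]
      rw [this, hw]
      rfl)

/-- Coning off chains with a new bottom vertex `b`. -/
def coneMap (f : α → β) (hf : ∀ ⦃a b⦄, rα a b → rβ (f a) (f b)) (b : β)
    (hb : ∀ a : α, rβ b (f a)) {n : ℕ} (c : OCh α rα n) : OCh β rβ (n + 1) :=
  ⟨Fin.cons b (f ∘ c.1), by
    intro i j hij
    rcases Fin.eq_zero_or_eq_succ j with hj | ⟨j', rfl⟩
    · subst hj; exact absurd hij (Fin.not_lt_zero i)
    · rcases Fin.eq_zero_or_eq_succ i with hi | ⟨i', rfl⟩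
      · subst hi; simpa using hb (c.1 j')
      · have h' : i' < j' := by simpa using hij
        simpa using hf (c.2 h')⟩

/-- The linear extension of `coneMap` to chain groups: `z ↦ b * z`. -/
noncomputable def coneL (f : α → β) (hf : ∀ ⦃a b⦄, rα a b → rβ (f a) (f b)) (b : β)
    (hb : ∀ a : α, rβ b (f a)) (n : ℕ) : ACh α rα n →ₗ[ℤ] ACh β rβ (n + 1) :=
  Finsupp.lmapDomain ℤ ℤ (coneMap f hf b hb)

end maps

section PosetConstructions

/-- The strict order of the poset `P_Q` on `Option P`, where `none` plays the role of the
adjoined minimal element `0̂_Q` lying below exactly the elements of `Q`. -/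
def extRel {P : Type*} (rP : P → P → Prop) (Q : Set P) : Option P → Option P → Prop
  | some x, some y => rP x y
  | none, some y => y ∈ Q
  | _, none => False

/-- The strict order of the poset suspension `Σ R` on `Bool ⊕ R`; `Sum.inl false` and
`Sum.inl true` are the two adjoined elements `0̂_R` and `0̂'_R`, lying below every element
of `R` and incomparable with each other. -/
def suspRel {R : Type*} (rR : R → R → Prop) : Bool ⊕ R → Bool ⊕ R → Prop
  | Sum.inl _, Sum.inr _ => True
  | Sum.inr a, Sum.inr b => rR a b
  | _, _ => False

/-- The underlying set of the wedge of suspensions `⋁_{t ∈ T} Σ Rₜ`: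
`none` is the adjoined minimal element `0̂`, `some (Sum.inl t)` is the element `t ∈ T`, and
`some (Sum.inr ⟨t, x⟩)` is the element `(x, t) ∈ Rₜ × {t}`. -/
abbrev WedgeP (T : Type*) (R : T → Type*) := Option (T ⊕ Σ t, R t)

/-- The strict order of the wedge of suspensions of the posets `Rₜ`. -/
def wRel {T : Type*} {R : T → Type*} (r : ∀ t, R t → R t → Prop) :
    WedgeP T R → WedgeP T R → Prop
  | none, some (Sum.inr _) => True
  | some (Sum.inl t), some (Sum.inr b) => t = b.1
  | some (Sum.inr a), some (Sum.inr b) => ∃ h : a.1 = b.1, r b.1 (h ▸ a.2) b.2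
  | _, _ => False

/-- The order complex of `(α, r)` restricted to the vertex set `S`: the abstract simplicial
complex whose simplices are the finite chains contained in `S`. -/
def cpx (α : Type*) (r : α → α → Prop) (S : Set α) : Set (Finset α) :=
  {s | ↑s ⊆ S ∧ ∀ a ∈ s, ∀ b ∈ s, a ≠ b → r a b ∨ r b a}

/-- The full order complex of `(α, r)`. -/
abbrev fullCpx (α : Type*) (r : α → α → Prop) : Set (Finset α) := cpx α r Set.univ

theorem empty_mem_cpx (α : Type*) (r : α → α → Prop) (S : Set α) : ∅ ∈ cpx α r S := by
  simp [cpx]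

/-- The length of the poset `(α, r)`: the supremum of the lengths of its chains. -/
noncomputable def posetLength (α : Type*) (r : α → α → Prop) : ℕ :=
  sSup {k : ℕ | Nonempty {f : Fin (k+1) → α // ∀ ⦃i j : Fin (k+1)⦄, i < j → r (f i) (f j)}}

theorem extRel_map_QQ {P : Type*} {rP : P → P → Prop} {Q : Set P} :
    ∀ ⦃a b : Option ↥Q⦄,
      extRel (fun x y : ↥Q => rP x y) Set.univ a b →
        extRel rP Q (Option.map Subtype.val a) (Option.map Subtype.val b) := by
  intro a b h
  match a, b with
  | none, some b => exact b.2
  | some a, some b => exact h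
  | none, none => exact h.elim
  | some _, none => exact h.elim

theorem extRel_optionMap {P : Type*} {rP : P → P → Prop} {Q : Set P} {f : P → P}
    (hf : ∀ ⦃a b⦄, rP a b → rP (f a) (f b)) (hfQ : ∀ ⦃q⦄, q ∈ Q → f q ∈ Q) :
    ∀ ⦃a b : Option P⦄, extRel rP Q a b → extRel rP Q (Option.map f a) (Option.map f b) := by
  intro a b h
  match a, b with
  | none, some b => exact hfQ h
  | some a, some b => exact hf h
  | none, none => exact h.elim
  | some _, none => exact h.elim

theorem suspRel_map {R : Type*} {rR : R → R → Prop} {f : R → R}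
    (hf : ∀ ⦃a b⦄, rR a b → rR (f a) (f b)) :
    ∀ ⦃a b : Bool ⊕ R⦄, suspRel rR a b → suspRel rR (Sum.map id f a) (Sum.map id f b) := by
  intro a b h
  match a, b with
  | Sum.inl x, Sum.inr b => trivial
  | Sum.inr a, Sum.inr b => exact hf h
  | Sum.inl x, Sum.inl y => exact h.elim
  | Sum.inr a, Sum.inl y => exact h.elim

theorem wRel_map {T : Type*} {R : T → Type*} {r : ∀ t, R t → R t → Prop}
    (fT : T → T) (fR : ∀ t, R t → R (fT t))
    (hf : ∀ (t : T) ⦃a b : R t⦄, r t a b → r (fT t) (fR t a) (fR t b)) :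
    ∀ ⦃a b : WedgeP T R⦄, wRel r a b →
      wRel r (Option.map (Sum.map fT (fun p => ⟨fT p.1, fR p.1 p.2⟩)) a)
        (Option.map (Sum.map fT (fun p => ⟨fT p.1, fR p.1 p.2⟩)) b) := by
  rintro (_ | (t | ⟨t, x⟩)) (_ | (t' | ⟨t', y⟩)) h <;> try exact h.elim
  · trivial
  · exact congrArg fT h
  · obtain ⟨ht, hr⟩ := h
    dsimp only at ht hr
    subst ht
    exact ⟨rfl, hf t hr⟩

end PosetConstructions

section ReflectionGroups

/-- The `ζ`-eigenspace `V(x, ζ)` of `x ∈ GL(V)` acting on `V = ℂⁿ`. -/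
noncomputable def eigSp {n : ℕ} (x : Matrix.GeneralLinearGroup (Fin n) ℂ) (ζ : ℂ) :
    Submodule ℂ (Fin n → ℂ) :=
  Module.End.eigenspace (Matrix.toLin' (x : Matrix (Fin n) (Fin n) ℂ)) ζ

/-- The fixed subspace of `g`. -/
noncomputable def fixSp {n : ℕ} (g : Matrix.GeneralLinearGroup (Fin n) ℂ) :
    Submodule ℂ (Fin n → ℂ) := eigSp g 1

/-- A reflection: a non-identity element whose fixed subspace is a hyperplane. -/
def IsReflection {n : ℕ} (g : Matrix.GeneralLinearGroup (Fin n) ℂ) : Prop :=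
  g ≠ 1 ∧ Module.finrank ℂ (fixSp g) = n - 1

/-- A (finite) unitary reflection group in `V = ℂⁿ`. -/
def IsUnitaryReflectionGroup {n : ℕ} (G : Subgroup (Matrix.GeneralLinearGroup (Fin n) ℂ)) :
    Prop :=
  (G : Set (Matrix.GeneralLinearGroup (Fin n) ℂ)).Finite ∧
  (∀ g ∈ G, (g : Matrix (Fin n) (Fin n) ℂ) ∈ Matrix.unitaryGroup (Fin n) ℂ) ∧
  Subgroup.closure {g | g ∈ G ∧ IsReflection g} = G

/-- `γ` normalises `G`. -/
def Normalises {n : ℕ} (γ : Matrix.GeneralLinearGroup (Fin n) ℂ)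
    (G : Subgroup (Matrix.GeneralLinearGroup (Fin n) ℂ)) : Prop :=
  ∀ g, g ∈ G ↔ γ * g * γ⁻¹ ∈ G

/-- The poset `S_ζ^V(γG)` of `ζ`-eigenspaces of elements of the reflection coset `γG`,
to be ordered by the *reverse* of inclusion. -/
def Sset {n : ℕ} (γ : Matrix.GeneralLinearGroup (Fin n) ℂ)
    (G : Subgroup (Matrix.GeneralLinearGroup (Fin n) ℂ)) (ζ : ℂ) :
    Set (Submodule ℂ (Fin n → ℂ)) :=
  {E | ∃ g ∈ G, E = eigSp (γ * g) ζ}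

/-- `S'_ζ^V(γG)`: `S_ζ^V(γG)` with the unique maximal element `1̂` (the smallest eigenspace)
removed. -/
def Sp {n : ℕ} (γ : Matrix.GeneralLinearGroup (Fin n) ℂ)
    (G : Subgroup (Matrix.GeneralLinearGroup (Fin n) ℂ)) (ζ : ℂ) :
    Set (Submodule ℂ (Fin n → ℂ)) :=
  {E ∈ Sset γ G ζ | ∃ F ∈ Sset γ G ζ, ¬ E ≤ F}

/-- `S̃_ζ^V(γG)`: `S_ζ^V(γG)` with the unique maximal element removed, and the unique
minimal element removed if it exists. -/
def Stilde {n : ℕ} (γ : Matrix.GeneralLinearGroup (Fin n) ℂ)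
    (G : Subgroup (Matrix.GeneralLinearGroup (Fin n) ℂ)) (ζ : ℂ) :
    Set (Submodule ℂ (Fin n → ℂ)) :=
  {E ∈ Sset γ G ζ | (∃ F ∈ Sset γ G ζ, ¬ E ≤ F) ∧ (∃ F ∈ Sset γ G ζ, ¬ F ≤ E)}

/-- `T'_ζ^V(γG)`: the non-maximal eigenspaces of `S'_ζ^V(γG)`. -/
def Tp {n : ℕ} (γ : Matrix.GeneralLinearGroup (Fin n) ℂ)
    (G : Subgroup (Matrix.GeneralLinearGroup (Fin n) ℂ)) (ζ : ℂ) :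
    Set (Submodule ℂ (Fin n → ℂ)) :=
  {E ∈ Sp γ G ζ | ∃ F ∈ Sp γ G ζ, E < F}

/-- The set of maximal eigenspaces, `M = S' \ T'`. -/
def Mp {n : ℕ} (γ : Matrix.GeneralLinearGroup (Fin n) ℂ)
    (G : Subgroup (Matrix.GeneralLinearGroup (Fin n) ℂ)) (ζ : ℂ) :
    Set (Submodule ℂ (Fin n → ℂ)) :=
  {E ∈ Sp γ G ζ | ∀ F ∈ Sp γ G ζ, ¬ E < F}

/-- The strict order of `S'_ζ^V(γG)` (reverse inclusion). -/
def rSp {n : ℕ} (γ : Matrix.GeneralLinearGroup (Fin n) ℂ)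
    (G : Subgroup (Matrix.GeneralLinearGroup (Fin n) ℂ)) (ζ : ℂ) :
    ↥(Sp γ G ζ) → ↥(Sp γ G ζ) → Prop :=
  fun E F => F.1 < E.1

/-- The strict order of `U'_ζ^V(γG)` on `Option ↥(S'_ζ^V(γG))`, where `none` is the adjoined
element `0̂_S` lying below exactly the elements of `T'_ζ^V(γG)`. -/
def Urel {n : ℕ} (γ : Matrix.GeneralLinearGroup (Fin n) ℂ)
    (G : Subgroup (Matrix.GeneralLinearGroup (Fin n) ℂ)) (ζ : ℂ) :
    Option ↥(Sp γ G ζ) → Option ↥(Sp γ G ζ) → Prop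
  | some E, some F => F.1 < E.1
  | none, some F => F.1 ∈ Tp γ G ζ
  | _, none => False

end ReflectionGroups

/-- The matrix of an element of a subgroup of `GL(n, ℂ)`. -/
noncomputable abbrev matOf {n : ℕ} {G : Subgroup (Matrix.GeneralLinearGroup (Fin n) ℂ)}
    (g : ↥G) : Matrix (Fin n) (Fin n) ℂ :=
  ((g : Matrix.GeneralLinearGroup (Fin n) ℂ) : Matrix (Fin n) (Fin n) ℂ)

section Suspension

variable {R X : Type*} {rR : R → R → Prop} {rX : X → X → Prop}

/-- `(X, rX)` is the suspension of `(R, rR)`, embedded in it by `f`: the two further elements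
`a` and `b` of `X` are incomparable and lie below every element of `R`. -/
structure IsSuspension (rR : R → R → Prop) (rX : X → X → Prop) (f : R → X) (a b : X) :
    Prop where
  injective : Function.Injective f
  map_rel : ∀ ⦃x y⦄, rR x y → rX (f x) (f y)
  of_map_rel : ∀ ⦃x y⦄, rX (f x) (f y) → rR x y
  left_rel : ∀ x, rX a (f x)
  right_rel : ∀ x, rX b (f x)
  not_rel_left : ∀ x, ¬ rX x a
  not_rel_right : ∀ x, ¬ rX x b
  ne : a ≠ b
  cover : ∀ x, x = a ∨ x = b ∨ x ∈ Set.range f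

theorem coneMap_injective {f : R → X} (hf : ∀ ⦃x y⦄, rR x y → rX (f x) (f y)) {b : X}
    (hb : ∀ x, rX b (f x)) (hinj : Function.Injective f) (n : ℕ) :
    Function.Injective (coneMap (n := n) f hf b hb) := by
  intro c d h
  have h' := Fin.cons_right_injective (α := fun _ => X) b (congrArg Subtype.val h)
  exact Subtype.ext (funext fun i => hinj (congrFun h' i))

theorem cmap_injective {f : R → X} (hf : ∀ ⦃x y⦄, rR x y → rX (f x) (f y))
    (hinj : Function.Injective f) (n : ℕ) : Function.Injective (cmap (n := n) f hf) := by
  intro c d h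
  exact Subtype.ext (funext fun i => hinj (congrFun (congrArg Subtype.val h) i))

/-- The boundary of a cone: `∂(b * z) = z - b * ∂z`. -/
theorem bdry_coneL (f : R → X) (hf : ∀ ⦃x y⦄, rR x y → rX (f x) (f y)) (b : X)
    (hb : ∀ x, rX b (f x)) (n : ℕ) (z : ACh R rR (n + 1)) :
    bdry X rX (n + 1) (coneL f hf b hb (n + 1) z) =
      cmapL f hf (n + 1) z - coneL f hf b hb n (bdry R rR n z) := by
  suffices h : (bdry X rX (n + 1)).comp (coneL f hf b hb (n + 1)) =
      cmapL f hf (n + 1) - (coneL f hf b hb n).comp (bdry R rR n) from LinearMap.congr_fun h z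
  have hzero (c : OCh R rR (n + 1)) : (coneMap f hf b hb c).face 0 = cmap f hf c :=
    Subtype.ext (funext fun i => by simp [OCh.face, coneMap, cmap])
  have hsucc (c : OCh R rR (n + 1)) (i : Fin (n + 1)) :
      (coneMap f hf b hb c).face i.succ = coneMap f hf b hb (c.face i) := by
    refine Subtype.ext (funext fun j => ?_)
    refine Fin.cases ?_ (fun j => ?_) j
    · simp [OCh.face, coneMap]
    · simp [OCh.face, coneMap, Fin.removeNth]
  refine Finsupp.lhom_ext' fun c => LinearMap.ext_ring ?_
  simp only [LinearMap.comp_apply, LinearMap.sub_apply, coneL, cmapL, Finsupp.lmapDomain_apply,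
    Finsupp.mapDomain_single, bdry_single, one_smul, Finsupp.lsingle_apply]
  rw [Fin.sum_univ_succ, ← Finsupp.lmapDomain_apply ℤ ℤ (coneMap f hf b hb), map_sum]
  simp [hzero, hsucc, Finsupp.lmapDomain_apply, Finsupp.mapDomain_single, pow_succ,
    Finset.sum_neg_distrib, sub_eq_add_neg]

theorem bdry_cmapL_apply (f : R → X) (hf : ∀ ⦃x y⦄, rR x y → rX (f x) (f y)) (n : ℕ)
    (z : ACh R rR (n + 1)) :
    bdry X rX n (cmapL f hf (n + 1) z) = cmapL f hf n (bdry R rR n z) :=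
  LinearMap.congr_fun (bdry_cmapL f hf n) z

theorem lcomapDomain_lmapDomain {α β : Type*} (g : α → β) (hg : Function.Injective g)
    (z : α →₀ ℤ) :
    Finsupp.lcomapDomain (R := ℤ) g hg (Finsupp.lmapDomain ℤ ℤ g z) = z := by
  ext x
  simp [Finsupp.lcomapDomain, Finsupp.mapDomain_apply hg]

theorem lcomapDomain_lmapDomain_of_ne {α β γ : Type*} (g : α → β) (hg : Function.Injective g)
    (g' : γ → β) (hne : ∀ x y, g x ≠ g' y) (z : γ →₀ ℤ) :
    Finsupp.lcomapDomain (R := ℤ) g hg (Finsupp.lmapDomain ℤ ℤ g' z) = 0 := by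
  ext x
  have hx : g x ∉ Set.range g' := fun ⟨y, hy⟩ => hne x y hy.symm
  simp [Finsupp.lcomapDomain, Finsupp.mapDomain_of_notMem_range _ _ hx]

namespace IsSuspension

variable {f : R → X} {a b : X} (H : IsSuspension rR rX f a b)
include H

theorem left_ne (x : R) : a ≠ f x := fun h => H.not_rel_left a (h ▸ H.left_rel x)

theorem right_ne (x : R) : b ≠ f x := fun h => H.not_rel_right b (h ▸ H.right_rel x)

theorem mem_range_of_rel {x y : X} (h : rX x y) : y ∈ Set.range f := by
  rcases H.cover y with rfl | rfl | hy
  · exact (H.not_rel_left _ h).elim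
  · exact (H.not_rel_right _ h).elim
  · exact hy

theorem exists_cmap {n : ℕ} (c : OCh X rX n) (hc : ∀ i, c.1 i ∈ Set.range f) :
    ∃ d, cmap f H.map_rel d = c := by
  choose d hd using hc
  refine ⟨⟨d, fun i j hij => H.of_map_rel ?_⟩, Subtype.ext (funext hd)⟩
  rw [hd, hd]
  exact c.2 hij

theorem exists_coneMap {n : ℕ} (c : OCh X rX (n + 1)) (hb : ∀ x, rX (c.1 0) (f x)) :
    ∃ d, coneMap f H.map_rel (c.1 0) hb d = c := by
  obtain ⟨d, hd⟩ := H.exists_cmap ⟨fun i => c.1 i.succ, fun i j hij => c.2 (by simpa using hij)⟩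
    fun i => H.mem_range_of_rel (c.2 (Fin.succ_pos i))
  refine ⟨d, Subtype.ext (funext fun i => ?_)⟩
  refine Fin.cases rfl (fun i => ?_) i
  exact congrFun (congrArg Subtype.val hd) i

theorem chain_cases {n : ℕ} (c : OCh X rX (n + 1)) :
    (∃ d, coneMap f H.map_rel a H.left_rel d = c) ∨
      (∃ d, coneMap f H.map_rel b H.right_rel d = c) ∨ ∃ d, cmap f H.map_rel d = c := by
  rcases H.cover (c.1 0) with h | h | h
  · left
    subst h
    exact H.exists_coneMap c H.left_rel
  · right; left
    subst h
    exact H.exists_coneMap c H.right_rel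
  · right; right
    refine H.exists_cmap c fun i => ?_
    refine Fin.cases h (fun i => ?_) i
    exact H.mem_range_of_rel (c.2 (Fin.succ_pos i))

theorem lhom_ext {n : ℕ} {M : Type*} [AddCommGroup M] {φ ψ : ACh X rX (n + 1) →ₗ[ℤ] M}
    (hleft : ∀ z, φ (coneL f H.map_rel a H.left_rel n z) = ψ (coneL f H.map_rel a H.left_rel n z))
    (hright : ∀ z,
      φ (coneL f H.map_rel b H.right_rel n z) = ψ (coneL f H.map_rel b H.right_rel n z))
    (hmap : ∀ z, φ (cmapL f H.map_rel (n + 1) z) = ψ (cmapL f H.map_rel (n + 1) z)) : φ = ψ := by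
  refine Finsupp.lhom_ext fun c m => ?_
  rcases H.chain_cases c with ⟨d, rfl⟩ | ⟨d, rfl⟩ | ⟨d, rfl⟩
  · simpa [coneL, Finsupp.mapDomain_single] using hleft (Finsupp.single d m)
  · simpa [coneL, Finsupp.mapDomain_single] using hright (Finsupp.single d m)
  · simpa [cmapL, Finsupp.mapDomain_single] using hmap (Finsupp.single d m)

/-- The suspension of chains, `z ↦ a * z - b * z`. -/
noncomputable def susp (n : ℕ) : ACh R rR n →ₗ[ℤ] ACh X rX (n + 1) :=
  coneL f H.map_rel a H.left_rel n - coneL f H.map_rel b H.right_rel n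

/-- The link of `a`: the chain `a * z` is sent to `z`, and chains avoiding `a` to `0`. -/
noncomputable def link (n : ℕ) : ACh X rX (n + 1) →ₗ[ℤ] ACh R rR n :=
  Finsupp.lcomapDomain (coneMap f H.map_rel a H.left_rel)
    (coneMap_injective H.map_rel H.left_rel H.injective n)

/-- The restriction of chains of `X` to `R`. -/
noncomputable def restr (n : ℕ) : ACh X rX n →ₗ[ℤ] ACh R rR n :=
  Finsupp.lcomapDomain (cmap f H.map_rel) (cmap_injective H.map_rel H.injective n)

theorem link_coneL_left (n : ℕ) (z : ACh R rR n) :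
    H.link n (coneL f H.map_rel a H.left_rel n z) = z :=
  lcomapDomain_lmapDomain _ _ z

theorem link_coneL_right (n : ℕ) (z : ACh R rR n) :
    H.link n (coneL f H.map_rel b H.right_rel n z) = 0 :=
  lcomapDomain_lmapDomain_of_ne _ _ _
    (fun _ _ h => H.ne (congrFun (congrArg Subtype.val h) 0)) z

theorem link_cmapL (n : ℕ) (z : ACh R rR (n + 1)) :
    H.link n (cmapL f H.map_rel (n + 1) z) = 0 :=
  lcomapDomain_lmapDomain_of_ne _ _ _
    (fun _ _ h => H.left_ne _ (congrFun (congrArg Subtype.val h) 0)) z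

theorem restr_coneL_left (n : ℕ) (z : ACh R rR n) :
    H.restr (n + 1) (coneL f H.map_rel a H.left_rel n z) = 0 :=
  lcomapDomain_lmapDomain_of_ne _ _ _
    (fun _ _ h => H.left_ne _ (congrFun (congrArg Subtype.val h) 0).symm) z

theorem restr_coneL_right (n : ℕ) (z : ACh R rR n) :
    H.restr (n + 1) (coneL f H.map_rel b H.right_rel n z) = 0 :=
  lcomapDomain_lmapDomain_of_ne _ _ _
    (fun _ _ h => H.right_ne _ (congrFun (congrArg Subtype.val h) 0).symm) z

theorem restr_cmapL (n : ℕ) (z : ACh R rR n) : H.restr n (cmapL f H.map_rel n z) = z :=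
  lcomapDomain_lmapDomain _ _ z

theorem link_susp (n : ℕ) (z : ACh R rR n) : H.link n (H.susp n z) = z := by
  simp [susp, link_coneL_left, link_coneL_right]

theorem bdry_susp (n : ℕ) (z : ACh R rR (n + 1)) :
    bdry X rX (n + 1) (H.susp (n + 1) z) = -H.susp n (bdry R rR n z) := by
  simp only [susp, LinearMap.sub_apply, map_sub, bdry_coneL]
  abel

theorem bdry_link (n : ℕ) (z : ACh X rX (n + 2)) :
    bdry R rR n (H.link (n + 1) z) = -H.link n (bdry X rX (n + 1) z) := by
  suffices h : (bdry R rR n).comp (H.link (n + 1)) = -(H.link n).comp (bdry X rX (n + 1)) from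
    LinearMap.congr_fun h z
  refine H.lhom_ext (fun z => ?_) (fun z => ?_) fun z => ?_ <;>
  simp [link_coneL_left, link_coneL_right, link_cmapL, bdry_coneL, bdry_cmapL_apply]

/-- Coning the part of a chain in `R` off with `b` is a chain homotopy from `susp ∘ link` to the
identity. -/
theorem sub_susp_link (n : ℕ) (z : ACh X rX (n + 2)) :
    z - H.susp (n + 1) (H.link (n + 1) z) =
      bdry X rX (n + 2) (coneL f H.map_rel b H.right_rel (n + 2) (H.restr (n + 2) z)) +
        coneL f H.map_rel b H.right_rel (n + 1) (H.restr (n + 1) (bdry X rX (n + 1) z)) := by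
  suffices h : LinearMap.id - (H.susp (n + 1)).comp (H.link (n + 1)) =
      (bdry X rX (n + 2)).comp
          ((coneL f H.map_rel b H.right_rel (n + 2)).comp (H.restr (n + 2))) +
        (coneL f H.map_rel b H.right_rel (n + 1)).comp
          ((H.restr (n + 1)).comp (bdry X rX (n + 1))) from LinearMap.congr_fun h z
  refine H.lhom_ext (fun z => ?_) (fun z => ?_) fun z => ?_ <;>
  simp [link_coneL_left, link_coneL_right, link_cmapL, bdry_coneL, bdry_cmapL_apply,
    restr_coneL_left, restr_coneL_right, restr_cmapL, susp]

theorem susp_mem_cyc {n : ℕ} {z : ACh R rR (n + 1)} (hz : z ∈ cyc R rR n) :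
    H.susp (n + 1) z ∈ cyc X rX (n + 1) := by
  simp only [cyc, LinearMap.mem_ker] at hz ⊢
  rw [bdry_susp, hz, map_zero, neg_zero]

/-- The suspension map on reduced homology. -/
noncomputable def suspH (n : ℕ) : redH R rR n →ₗ[ℤ] redH X rX (n + 1) :=
  Submodule.mapQ _ _ ((H.susp (n + 1)).restrict fun _ hz => H.susp_mem_cyc hz) (by
    rintro ⟨z, hz⟩ ⟨w, hw⟩
    refine ⟨-H.susp (n + 2) w, ?_⟩
    simp only [Submodule.subtype_apply] at hw
    simp [LinearMap.restrict_apply, bdry_susp, hw])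

theorem suspH_injective (n : ℕ) : Function.Injective (H.suspH n) := by
  rw [injective_iff_map_eq_zero]
  intro x hx
  obtain ⟨⟨z, hz⟩, rfl⟩ := Submodule.Quotient.mk_surjective _ x
  rw [suspH, Submodule.mapQ_apply, Submodule.Quotient.mk_eq_zero] at hx
  obtain ⟨w, hw⟩ := hx
  rw [Submodule.Quotient.mk_eq_zero]
  refine ⟨-H.link (n + 2) w, ?_⟩
  simp only [Submodule.subtype_apply, LinearMap.restrict_apply] at hw
  simp [bdry_link, hw, link_susp]

theorem suspH_surjective (n : ℕ) : Function.Surjective (H.suspH n) := by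
  intro x
  obtain ⟨⟨z, hz⟩, rfl⟩ := Submodule.Quotient.mk_surjective _ x
  have hz' : bdry X rX (n + 1) z = 0 := hz
  have hlink : H.link (n + 1) z ∈ cyc R rR n := by
    simp [cyc, bdry_link, hz']
  refine ⟨Submodule.Quotient.mk ⟨_, hlink⟩, ?_⟩
  rw [suspH, Submodule.mapQ_apply, eq_comm, Submodule.Quotient.eq]
  refine ⟨coneL f H.map_rel b H.right_rel (n + 2) (H.restr (n + 2) z), ?_⟩
  have h := H.sub_susp_link n z
  rw [hz', map_zero, map_zero, add_zero] at h
  exact h.symm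

/-- The suspension isomorphism on reduced homology. -/
noncomputable def suspEquiv (n : ℕ) : redH R rR n ≃ₗ[ℤ] redH X rX (n + 1) :=
  LinearEquiv.ofBijective (H.suspH n) ⟨H.suspH_injective n, H.suspH_surjective n⟩

theorem suspEquiv_indH {s : X → X} (hs : ∀ ⦃x y⦄, rX x y → rX (s x) (s y)) {t : R → R}
    (ht : ∀ ⦃x y⦄, rR x y → rR (t x) (t y)) (ha : s a = a) (hb : s b = b)
    (hst : ∀ x, s (f x) = f (t x)) (n : ℕ) (x : redH R rR n) :
    H.suspEquiv n (indH t ht n x) = indH s hs (n + 1) (H.suspEquiv n x) := by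
  obtain ⟨⟨z, hz⟩, rfl⟩ := Submodule.Quotient.mk_surjective _ x
  have hcone (v : X) (hv : ∀ x, rX v (f x)) (hsv : s v = v) (z : ACh R rR (n + 1)) :
      coneL f H.map_rel v hv (n + 1) (cmapL t ht (n + 1) z) =
        cmapL s hs (n + 2) (coneL f H.map_rel v hv (n + 1) z) := by
    simp only [coneL, cmapL, Finsupp.lmapDomain_apply, ← Finsupp.mapDomain_comp]
    congr 1
    refine funext fun c => Subtype.ext (funext fun i => ?_)
    refine Fin.cases ?_ (fun i => ?_) i <;> simp [coneMap, cmap, hsv, hst]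
  have hsusp : H.susp (n + 1) (cmapL t ht (n + 1) z) =
      cmapL s hs (n + 2) (H.susp (n + 1) z) := by
    simp only [susp, LinearMap.sub_apply, map_sub]
    rw [hcone a H.left_rel ha, hcone b H.right_rel hb]
  exact congrArg Submodule.Quotient.mk (Subtype.ext hsusp)

end IsSuspension

theorem redH_subsingleton {α : Type*} {r : α → α → Prop} {n : ℕ} [IsEmpty (OCh α r (n + 1))] :
    Subsingleton (redH α r n) := by
  have : Subsingleton (cyc α r n) := inferInstance
  exact (Submodule.Quotient.mk_surjective _).subsingleton

end Suspension

section Eigenspaces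

variable {n : ℕ} (G : Subgroup (Matrix.GeneralLinearGroup (Fin n) ℂ))

theorem top_mem_Sset : (⊤ : Submodule ℂ (Fin n → ℂ)) ∈ Sset 1 G 1 := by
  refine ⟨1, G.one_mem, ?_⟩
  ext v
  simp [eigSp]

/-- If `G` is nontrivial, then `U'₁ᵛ(G)` is the suspension of `S̃₁ᵛ(G)`, with the whole space and
`0̂_S` as the two adjoined elements. -/
theorem isSuspension_Urel (htop : ⊤ ∈ Sp 1 G 1) :
    IsSuspension
      (fun E F : ↥(Stilde 1 G 1) =>
        (F : Submodule ℂ (Fin n → ℂ)) < (E : Submodule ℂ (Fin n → ℂ)))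
      (Urel 1 G 1) (fun E => some ⟨E.1, E.2.1, E.2.2.1⟩) (some ⟨⊤, htop⟩) none where
  injective E F h := by simpa [Subtype.ext_iff] using h
  map_rel _ _ h := h
  of_map_rel _ _ h := h
  left_rel := by
    rintro ⟨E, hE, hE₁, F, hF, hFE⟩
    exact lt_top_iff_ne_top.2 fun h => hFE (le_top.trans_eq (Eq.symm h))
  right_rel := by
    rintro ⟨E, hE, hE₁, F, hF, hFE⟩
    exact ⟨⟨hE, hE₁⟩, ⊤, htop, lt_top_iff_ne_top.2 fun h => hFE (le_top.trans_eq (Eq.symm h))⟩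
  not_rel_left := by
    rintro (_ | E) h
    · obtain ⟨_, F, _, hF⟩ := h
      exact not_top_lt hF
    · exact not_top_lt h
  not_rel_right := by
    rintro (_ | E) h <;> exact h
  ne := by simp
  cover := by
    rintro (_ | ⟨E, hE⟩)
    · exact Or.inr (Or.inl rfl)
    · by_cases h : E = ⊤
      · subst h
        exact Or.inl rfl
      · exact Or.inr (Or.inr
          ⟨⟨E, hE.1, hE.2, ⊤, htop.1, fun h' => h (top_le_iff.1 h')⟩, rfl⟩)

theorem isEmpty_Sp (htop : ⊤ ∉ Sp 1 G 1) : IsEmpty ↥(Sp 1 G 1) := by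
  refine ⟨fun ⟨E, _, F, hF, hEF⟩ => htop ⟨top_mem_Sset G, F, hF, fun h => hEF ?_⟩⟩
  exact le_top.trans h

theorem map_toLin'_matOf_top (g : ↥G) :
    Submodule.map (Matrix.toLin' (matOf g)) ⊤ = ⊤ := by
  rw [Submodule.map_top, LinearMap.range_eq_top]
  intro v
  refine ⟨(matOf g)⁻¹.mulVec v, ?_⟩
  rw [Matrix.toLin'_apply, Matrix.mulVec_mulVec, Matrix.mul_nonsing_inv, Matrix.one_mulVec]
  exact (Matrix.isUnit_iff_isUnit_det _).1 g.1.isUnit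

end Eigenspaces

/-- Corollary 4.2.  For a finite unitary reflection group `G` on
`V = ℂⁿ`, `H̃ₙ₋₁(U'₁ᵛ(G)) ≅ H̃ₙ₋₂(S̃₁ᵛ(G))` as `ℤG`-modules.  The `G`-actions on the two
posets are given by taking images of eigenspaces (`g • V(x,1) = V(gxg⁻¹,1)`), realized here
by any order-preserving maps `σ`, `τ` with those values (and fixing the adjoined
element `0̂_S`). -/
theorem statement12 {n : ℕ} (G : Subgroup (Matrix.GeneralLinearGroup (Fin n) ℂ))
    (hG : IsUnitaryReflectionGroup G)
    (σ : ↥G → Option ↥(Sp 1 G 1) → Option ↥(Sp 1 G 1))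
    (hσnone : ∀ g, σ g none = none)
    (hσval : ∀ (g : ↥G) (E : ↥(Sp 1 G 1)), ∃ F : ↥(Sp 1 G 1),
      σ g (some E) = some F ∧
        (F : Submodule ℂ (Fin n → ℂ)) =
          Submodule.map (Matrix.toLin' (matOf g)) (E : Submodule ℂ (Fin n → ℂ)))
    (hσmono : ∀ g : ↥G, ∀ ⦃x y⦄, Urel 1 G 1 x y → Urel 1 G 1 (σ g x) (σ g y))
    (τ : ↥G → ↥(Stilde 1 G 1) → ↥(Stilde 1 G 1))
    (hτval : ∀ (g : ↥G) (E : ↥(Stilde 1 G 1)),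
      ((τ g E : Submodule ℂ (Fin n → ℂ))) =
        Submodule.map (Matrix.toLin' (matOf g)) (E : Submodule ℂ (Fin n → ℂ)))
    (hτmono : ∀ g : ↥G, ∀ ⦃x y : ↥(Stilde 1 G 1)⦄,
      (y : Submodule ℂ (Fin n → ℂ)) < (x : Submodule ℂ (Fin n → ℂ)) →
      ((τ g y : Submodule ℂ (Fin n → ℂ))) < ((τ g x : Submodule ℂ (Fin n → ℂ))))
    (k : ℕ) (hnk : n = k + 2) :
    ∃ e : redH (Option ↥(Sp 1 G 1)) (Urel 1 G 1) (k + 1) ≃ₗ[ℤ]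
        redH ↥(Stilde 1 G 1)
          (fun E F : ↥(Stilde 1 G 1) =>
            (F : Submodule ℂ (Fin n → ℂ)) < (E : Submodule ℂ (Fin n → ℂ))) k,
      ∀ (g : ↥G) (x : redH (Option ↥(Sp 1 G 1)) (Urel 1 G 1) (k + 1)),
        e (indH (rα := Urel 1 G 1) (rβ := Urel 1 G 1) (σ g) (hσmono g) (k + 1) x) =
          indH (rα := fun E F : ↥(Stilde 1 G 1) =>
              (F : Submodule ℂ (Fin n → ℂ)) < (E : Submodule ℂ (Fin n → ℂ)))
            (rβ := fun E F : ↥(Stilde 1 G 1) =>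
              (F : Submodule ℂ (Fin n → ℂ)) < (E : Submodule ℂ (Fin n → ℂ)))
            (τ g) (fun _ _ h => hτmono g h) k (e x) := by
  by_cases htop : ⊤ ∈ Sp 1 G 1
  · have H := isSuspension_Urel G htop
    refine ⟨(H.suspEquiv k).symm, fun g x => ?_⟩
    rw [LinearEquiv.symm_apply_eq, H.suspEquiv_indH (hσmono g) (fun _ _ h => hτmono g h),
      LinearEquiv.apply_symm_apply]
    · obtain ⟨F, hF, hFval⟩ := hσval g ⟨⊤, htop⟩
      rw [hF]
      exact congrArg some (Subtype.ext (hFval.trans (map_toLin'_matOf_top G g)))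
    · exact hσnone g
    · intro E
      obtain ⟨F, hF, hFval⟩ := hσval g ⟨E.1, E.2.1, E.2.2.1⟩
      rw [hF]
      exact congrArg some (Subtype.ext (hFval.trans (hτval g E).symm))
  · have hSp := isEmpty_Sp G htop
    have hX : IsEmpty (OCh (Option ↥(Sp 1 G 1)) (Urel 1 G 1) (k + 1 + 1)) := by
      refine ⟨fun c => ?_⟩
      have h := c.2 (Fin.succ_pos (0 : Fin (k + 1)))
      rw [Subsingleton.elim (c.1 0) none, Subsingleton.elim (c.1 _) none] at h
      exact h
    have hR : IsEmpty (OCh ↥(Stilde 1 G 1)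
        (fun E F : ↥(Stilde 1 G 1) =>
          (F : Submodule ℂ (Fin n → ℂ)) < (E : Submodule ℂ (Fin n → ℂ))) (k + 1)) :=
      ⟨fun c => hSp.false ⟨(c.1 0).1, (c.1 0).2.1, (c.1 0).2.2.1⟩⟩
    have := redH_subsingleton (r := Urel 1 G 1) (n := k + 1)
    have := redH_subsingleton (r := fun E F : ↥(Stilde 1 G 1) =>
      (F : Submodule ℂ (Fin n → ℂ)) < (E : Submodule ℂ (Fin n → ℂ))) (n := k)
    exact ⟨0, fun _ _ => Subsingleton.elim _ _⟩
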